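/- Let φ : A → B be a DG quasi-smooth homomorphism of strongly commutative DG R-algebras with diagonal ideal J and filtration {J^[ℓ]}. Let N be a bounded below semifree DG B-module with Ext^i_B(N, N ⊗_B J/J^[ℓ]) = 0 for all i ≥ 0 and all ℓ ≥ 1. Then Ext^i_B(N, N ⊗_B J) = 0 for all i ≥ 1. -/

import Mathlib

/-!
Common framework: strongly commutative non-negatively graded DG algebras over a
commutative ring `R`, right DG modules, semifree DG modules, Ext via the Hom complex,
homotopies, enveloping DG algebras, diagonal ideals, DG (quasi-)smoothness,
polynomial and free (divided power) extensions, and naive lifting.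
-/

noncomputable section

/-- The Koszul sign `(-1)^i` for an integer `i`. -/
def ksign (i : ℤ) : ℤ := (((-1 : ℤˣ) ^ i : ℤˣ) : ℤ)

/-- A strongly commutative, non-negatively graded differential graded algebra over a
commutative ring `R`: a graded `R`-algebra `A = ⊕_{n ≥ 0} A_n` with
`a * b = (-1)^{|a||b|} b * a`, `a^2 = 0` for `|a|` odd, and an `R`-linear degree `-1`
differential `d` with `d ∘ d = 0` satisfying the Leibniz rule. -/
structure DGAlgebra (R : Type) [CommRing R] where
  carrier : Type
  [ring : Ring carrier]
  [alg : Algebra R carrier]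
  grading : ℤ → Submodule R carrier
  indep : ∀ i : ℤ, Disjoint (grading i) (⨆ j ≠ i, grading j)
  spanning : (⨆ i, grading i) = ⊤
  nonneg : ∀ i : ℤ, i < 0 → grading i = ⊥
  one_mem : (1 : carrier) ∈ grading 0
  mul_mem : ∀ {i j : ℤ} {a b : carrier}, a ∈ grading i → b ∈ grading j →
    a * b ∈ grading (i + j)
  gcomm : ∀ {i j : ℤ} (a b : carrier), a ∈ grading i → b ∈ grading j →
    a * b = ksign (i * j) • (b * a)
  odd_sq : ∀ {i : ℤ} (a : carrier), Odd i → a ∈ grading i → a * a = 0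
  d : carrier → carrier
  d_add : ∀ a b, d (a + b) = d a + d b
  d_rsmul : ∀ (r : R) a, d (r • a) = r • d a
  d_mem : ∀ {i : ℤ} {a : carrier}, a ∈ grading i → d a ∈ grading (i - 1)
  d_sq : ∀ a, d (d a) = 0
  leibniz : ∀ {i : ℤ} (a b : carrier), a ∈ grading i →
    d (a * b) = d a * b + ksign i • (a * d b)

attribute [instance] DGAlgebra.ring DGAlgebra.alg

variable {R : Type} [CommRing R]

/-- A right DG module over a DG `R`-algebra `A`. -/
structure DGModule (R : Type) [CommRing R] (A : DGAlgebra R) where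
  carrier : Type
  [acg : AddCommGroup carrier]
  [modR : Module R carrier]
  grading : ℤ → Submodule R carrier
  indep : ∀ i : ℤ, Disjoint (grading i) (⨆ j ≠ i, grading j)
  spanning : (⨆ i, grading i) = ⊤
  smul : carrier → A.carrier → carrier
  smul_add : ∀ (m : carrier) (a b : A.carrier), smul m (a + b) = smul m a + smul m b
  add_smul : ∀ (m n : carrier) (a : A.carrier), smul (m + n) a = smul m a + smul n a
  smul_rsmul : ∀ (r : R) (m : carrier) (a : A.carrier), smul m (r • a) = r • smul m a
  rsmul_smul : ∀ (r : R) (m : carrier) (a : A.carrier), smul (r • m) a = r • smul m a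
  smul_one : ∀ m : carrier, smul m 1 = m
  smul_mul : ∀ (m : carrier) (a b : A.carrier), smul (smul m a) b = smul m (a * b)
  smul_mem : ∀ {i j : ℤ} {m : carrier} {a : A.carrier},
    m ∈ grading i → a ∈ A.grading j → smul m a ∈ grading (i + j)
  d : carrier → carrier
  d_add : ∀ x y, d (x + y) = d x + d y
  d_rsmul : ∀ (r : R) x, d (r • x) = r • d x
  d_mem : ∀ {i : ℤ} {m : carrier}, m ∈ grading i → d m ∈ grading (i - 1)
  d_sq : ∀ m, d (d m) = 0
  leibniz : ∀ {i : ℤ} (m : carrier) (a : A.carrier), m ∈ grading i →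
    d (smul m a) = smul (d m) a + ksign i • smul m (A.d a)

attribute [instance] DGModule.acg DGModule.modR

/-- A graded `A`-linear map of degree `k` between DG `A`-modules (not necessarily
compatible with the differentials). -/
structure GradedHom {A : DGAlgebra R} (M N : DGModule R A) (k : ℤ) where
  toFun : M.carrier → N.carrier
  map_add : ∀ x y, toFun (x + y) = toFun x + toFun y
  map_rsmul : ∀ (r : R) x, toFun (r • x) = r • toFun x
  map_smul : ∀ (x : M.carrier) (a : A.carrier), toFun (M.smul x a) = N.smul (toFun x) a
  map_mem : ∀ {i : ℤ} {x : M.carrier}, x ∈ M.grading i → toFun x ∈ N.grading (i + k)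

/-- A homomorphism of DG `A`-modules: a degree `0` graded `A`-linear chain map. -/
structure DGHom {A : DGAlgebra R} (M N : DGModule R A) where
  toFun : M.carrier → N.carrier
  map_add : ∀ x y, toFun (x + y) = toFun x + toFun y
  map_rsmul : ∀ (r : R) x, toFun (r • x) = r • toFun x
  map_smul : ∀ (x : M.carrier) (a : A.carrier), toFun (M.smul x a) = N.smul (toFun x) a
  map_mem : ∀ {i : ℤ} {x : M.carrier}, x ∈ M.grading i → toFun x ∈ N.grading i
  comm_d : ∀ x, toFun (M.d x) = N.d (toFun x)

/-- A degree `-k` element `f` of the Hom complex `Hom_A(N, M)` is a cocycle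
(representing a class in `Ext^k_A(N,M) = H_{-k}(Hom_A(N,M))`). -/
def IsExtCocycle {A : DGAlgebra R} {N M : DGModule R A} (k : ℤ)
    (f : GradedHom N M (-k)) : Prop :=
  ∀ x, M.d (f.toFun x) = ksign k • f.toFun (N.d x)

/-- A degree `-k` cocycle of the Hom complex is a coboundary. -/
def IsExtCoboundary {A : DGAlgebra R} {N M : DGModule R A} (k : ℤ)
    (f : GradedHom N M (-k)) : Prop :=
  ∃ h : GradedHom N M (-k + 1), ∀ x,
    f.toFun x = M.d (h.toFun x) + ksign k • h.toFun (N.d x)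

/-- `Ext^k_A(N, M) = H_{-k}(Hom_A(N, M)) = 0`. -/
def ExtVanish {A : DGAlgebra R} (k : ℤ) (N M : DGModule R A) : Prop :=
  ∀ f : GradedHom N M (-k), IsExtCocycle k f → IsExtCoboundary k f

/-- A DG module homomorphism `j : M' → M` induces an isomorphism
`Ext^k_A(N, M') ≅ Ext^k_A(N, M)`; stated at the level of cocycles and coboundaries
of the Hom complexes (injectivity and surjectivity of the induced map on `H_{-k}`). -/
def InducesExtIso {A : DGAlgebra R} (k : ℤ) (N : DGModule R A) {M' M : DGModule R A}
    (j : DGHom M' M) : Prop :=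
  (∀ f : GradedHom N M' (-k), IsExtCocycle k f →
    (∃ h : GradedHom N M (-k + 1), ∀ x,
      j.toFun (f.toFun x) = M.d (h.toFun x) + ksign k • h.toFun (N.d x)) →
    IsExtCoboundary k f) ∧
  (∀ g : GradedHom N M (-k), IsExtCocycle k g →
    ∃ f : GradedHom N M' (-k), IsExtCocycle k f ∧
      ∃ h : GradedHom N M (-k + 1), ∀ x,
        j.toFun (f.toFun x) - g.toFun x = M.d (h.toFun x) + ksign k • h.toFun (N.d x))

/-- Two maps of DG `A`-modules are homotopic: `f - g = ∂ ∘ h + h ∘ ∂` for a graded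
`A`-linear map `h` of degree `1`. -/
def DGHomotopic {A : DGAlgebra R} {M N : DGModule R A}
    (f g : M.carrier → N.carrier) : Prop :=
  ∃ h : GradedHom M N 1, ∀ x, f x - g x = N.d (h.toFun x) + h.toFun (M.d x)

/-- A DG module homomorphism `j : M' → M` induces a bijection
`Hom_{K(A)}(N, M') ≅ Hom_{K(A)}(N, M)` on homotopy classes of DG homomorphisms. -/
def InducesHtpyBij {A : DGAlgebra R} (N : DGModule R A) {M' M : DGModule R A}
    (j : DGHom M' M) : Prop :=
  (∀ f g : DGHom N M',
    DGHomotopic (fun x => j.toFun (f.toFun x)) (fun x => j.toFun (g.toFun x)) →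
    DGHomotopic f.toFun g.toFun) ∧
  (∀ g : DGHom N M, ∃ f : DGHom N M',
    DGHomotopic (fun x => j.toFun (f.toFun x)) g.toFun)

/-- A semifree basis of a DG `A`-module `N` on a family `e : κ → N`: a well-ordering
of `κ`, degrees making each `e k` homogeneous, such that `e` is a basis of the
underlying graded `A`-module and `∂(e k) ∈ Σ_{j < k} (e j)·A`. -/
structure SemifreeBasisOn {A : DGAlgebra R} (N : DGModule R A) {κ : Type}
    (e : κ → N.carrier) where
  lt : κ → κ → Prop
  wf : WellFounded lt
  trans : ∀ a b c, lt a b → lt b c → lt a c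
  trichotomous : ∀ a b, lt a b ∨ a = b ∨ lt b a
  deg : κ → ℤ
  homog : ∀ k, e k ∈ N.grading (deg k)
  basis : Function.Bijective
    (fun c : κ →₀ A.carrier => c.sum fun k a => N.smul (e k) a)
  d_lower : ∀ k, ∃ c : κ →₀ A.carrier, (∀ j ∈ c.support, lt j k) ∧
    N.d (e k) = c.sum fun j a => N.smul (e j) a

/-- A DG `A`-module is semifree if it admits a semifree basis. -/
def IsSemifree {A : DGAlgebra R} (N : DGModule R A) : Prop :=
  ∃ (κ : Type) (e : κ → N.carrier), Nonempty (SemifreeBasisOn N e)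

/-- A DG `A`-module has a finite semifree basis. -/
def HasFiniteSemifreeBasis {A : DGAlgebra R} (N : DGModule R A) : Prop :=
  ∃ (κ : Type) (e : κ → N.carrier), Finite κ ∧ Nonempty (SemifreeBasisOn N e)

/-- A DG module is bounded below: `N_i = 0` for `i ≪ 0`. -/
def BoundedBelow {A : DGAlgebra R} (N : DGModule R A) : Prop :=
  ∃ n₀ : ℤ, ∀ i : ℤ, i < n₀ → N.grading i = ⊥

/-- A homomorphism of DG `R`-algebras. -/
structure DGAlgHom (A B : DGAlgebra R) where
  toFun : A.carrier → B.carrier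
  map_one : toFun 1 = 1
  map_mul : ∀ x y, toFun (x * y) = toFun x * toFun y
  map_add : ∀ x y, toFun (x + y) = toFun x + toFun y
  map_rsmul : ∀ (r : R) x, toFun (r • x) = r • toFun x
  map_mem : ∀ {i : ℤ} {x : A.carrier}, x ∈ A.grading i → toFun x ∈ B.grading i
  comm_d : ∀ x, toFun (A.d x) = B.d (toFun x)

/-- A DG `A`-module homomorphism from a DG `A`-module `M` to (the restriction of
scalars along `φ : A → B` of) a DG `B`-module `W`. -/
structure ResHom {A B : DGAlgebra R} (φ : DGAlgHom A B) (M : DGModule R A)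
    (W : DGModule R B) where
  toFun : M.carrier → W.carrier
  map_add : ∀ x y, toFun (x + y) = toFun x + toFun y
  map_rsmul : ∀ (r : R) x, toFun (r • x) = r • toFun x
  map_mem : ∀ {i : ℤ} {x : M.carrier}, x ∈ M.grading i → toFun x ∈ W.grading i
  map_smul : ∀ (x : M.carrier) (a : A.carrier),
    toFun (M.smul x a) = W.smul (toFun x) (φ.toFun a)
  comm_d : ∀ x, toFun (M.d x) = W.d (toFun x)

/-- `T` is (up to isomorphism) the base change `M ⊗_A B` of the DG `A`-module `M`
along `φ : A → B`: universal property of the unit map `M → T`, `m ↦ m ⊗ 1`. -/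
structure DGBaseChange {A B : DGAlgebra R} (φ : DGAlgHom A B) (M : DGModule R A)
    (T : DGModule R B) where
  unit : ResHom φ M T
  univ : ∀ (W : DGModule R B) (f : ResHom φ M W),
    ∃ g : DGHom T W, (∀ x, g.toFun (unit.toFun x) = f.toFun x) ∧
      ∀ g' : DGHom T W, (∀ x, g'.toFun (unit.toFun x) = f.toFun x) →
        ∀ t, g'.toFun t = g.toFun t

/-- A DG `B`-module `W` is liftable to `A` along `φ : A → B` if `W ≅ M ⊗_A B`
for some DG `A`-module `M`. -/
def LiftableTo {A B : DGAlgebra R} (φ : DGAlgHom A B) (W : DGModule R B) : Prop :=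
  ∃ M : DGModule R A, Nonempty (DGBaseChange φ M W)

/-- An `A`-linear (via `φ : A → B`) chain map between the restrictions of two
DG `B`-modules. -/
structure ResHomB {A B : DGAlgebra R} (φ : DGAlgHom A B) (N W : DGModule R B) where
  toFun : N.carrier → W.carrier
  map_add : ∀ x y, toFun (x + y) = toFun x + toFun y
  map_rsmul : ∀ (r : R) x, toFun (r • x) = r • toFun x
  map_mem : ∀ {i : ℤ} {x : N.carrier}, x ∈ N.grading i → toFun x ∈ W.grading i
  map_smul : ∀ (x : N.carrier) (a : A.carrier),
    toFun (N.smul x (φ.toFun a)) = W.smul (toFun x) (φ.toFun a)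
  comm_d : ∀ x, toFun (N.d x) = W.d (toFun x)

/-- `T` is (up to isomorphism) the induced DG `B`-module `N|_A ⊗_A B` of a
DG `B`-module `N` along `φ : A → B`, with unit map `n ↦ n ⊗ 1`. -/
structure InducedModuleSpec {A B : DGAlgebra R} (φ : DGAlgHom A B)
    (N T : DGModule R B) where
  unit : ResHomB φ N T
  univ : ∀ (W : DGModule R B) (f : ResHomB φ N W),
    ∃ g : DGHom T W, (∀ x, g.toFun (unit.toFun x) = f.toFun x) ∧
      ∀ g' : DGHom T W, (∀ x, g'.toFun (unit.toFun x) = f.toFun x) →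
        ∀ t, g'.toFun t = g.toFun t

/-- `N` is naively liftable to `A` along `φ : A → B`: the canonical DG `B`-module
epimorphism `π_N : N|_A ⊗_A B → N`, `n ⊗ b ↦ nb` (characterized as the unique
DG `B`-map splitting the unit) admits a right inverse DG `B`-module homomorphism. -/
def NaivelyLiftable {A B : DGAlgebra R} (φ : DGAlgHom A B) (N : DGModule R B) : Prop :=
  ∀ (T : DGModule R B) (h : InducedModuleSpec φ N T) (πN : DGHom T N),
    (∀ x, πN.toFun (h.unit.toFun x) = x) →
    ∃ ρ : DGHom N T, ∀ y, πN.toFun (ρ.toFun y) = y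

/-- `N` is a direct summand of `W` as DG modules. -/
def IsDGDirectSummandOf {A : DGAlgebra R} (N W : DGModule R A) : Prop :=
  ∃ (ρ : DGHom N W) (p : DGHom W N), ∀ x, p.toFun (ρ.toFun x) = x

/-- `N` is a direct summand of some DG `B`-module which is liftable to `A`. -/
def DirectSummandOfLiftable {A B : DGAlgebra R} (φ : DGAlgHom A B)
    (N : DGModule R B) : Prop :=
  ∃ W : DGModule R B, LiftableTo φ W ∧ IsDGDirectSummandOf N W

/-- `B` is free as an underlying graded `A`-module (via `φ : A → B`), with a basis
of homogeneous elements. -/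
def FreeOverBase {A B : DGAlgebra R} (φ : DGAlgHom A B) : Prop :=
  ∃ (κ : Type) (e : κ → B.carrier) (dg : κ → ℤ),
    (∀ k, e k ∈ B.grading (dg k)) ∧
    Function.Bijective (fun c : κ →₀ A.carrier => c.sum fun k a => e k * φ.toFun a)

/-- `E` is (up to isomorphism) the enveloping DG algebra `B^e = B^o ⊗_A B` of
`φ : A → B`: it receives the two canonical maps `l : B° → E`, `b ↦ b^o ⊗ 1` and
`r : B → E`, `b ↦ 1^o ⊗ b` agreeing on `A`, and is universal (as a pushout of
strongly commutative DG algebras) with this property. -/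
structure EnvelopingAlg {A B : DGAlgebra R} (φ : DGAlgHom A B) (E : DGAlgebra R) where
  l : DGAlgHom B E
  r : DGAlgHom B E
  compat : ∀ a, l.toFun (φ.toFun a) = r.toFun (φ.toFun a)
  univ : ∀ (C : DGAlgebra R) (f g : DGAlgHom B C),
    (∀ a, f.toFun (φ.toFun a) = g.toFun (φ.toFun a)) →
    ∃ h : DGAlgHom E C, (∀ b, h.toFun (l.toFun b) = f.toFun b) ∧
      (∀ b, h.toFun (r.toFun b) = g.toFun b) ∧
      ∀ h' : DGAlgHom E C,
        ((∀ b, h'.toFun (l.toFun b) = f.toFun b) ∧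
          (∀ b, h'.toFun (r.toFun b) = g.toFun b)) → ∀ x, h'.toFun x = h.toFun x

/-- The diagonal ideal `J = ker(π_B : B^e → B)`. -/
def diagIdeal {A B E : DGAlgebra R} {φ : DGAlgHom A B} (_ : EnvelopingAlg φ E)
    (πB : DGAlgHom E B) : Set E.carrier :=
  {x | πB.toFun x = 0}

/-- A balanced pairing `N × S → W` realizing (maps out of) `N ⊗_B (S/Z)`, where
`S ⊆ B^e` is a DG `(B,B)`-sub-bimodule of `B^e` (left `B`-action via `l`, right
`B`-action via `r`) and `Z ⊆ S` is killed. -/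
structure TensorPairing {A B E : DGAlgebra R} (φ : DGAlgHom A B)
    (he : EnvelopingAlg φ E) (S Z : Set E.carrier) (N W : DGModule R B) where
  pair : N.carrier → E.carrier → W.carrier
  add_left : ∀ n n' x, x ∈ S → pair (n + n') x = pair n x + pair n' x
  add_right : ∀ n x y, x ∈ S → y ∈ S → pair n (x + y) = pair n x + pair n y
  rsmul_left : ∀ (r : R) n x, x ∈ S → pair (r • n) x = r • pair n x
  rsmul_right : ∀ (r : R) n x, x ∈ S → pair n (r • x) = r • pair n x
  balanced : ∀ (n : N.carrier) (b : B.carrier) (x : E.carrier), x ∈ S →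
    pair (N.smul n b) x = pair n (he.l.toFun b * x)
  act_right : ∀ (n : N.carrier) (b : B.carrier) (x : E.carrier), x ∈ S →
    pair n (x * he.r.toFun b) = W.smul (pair n x) b
  grade : ∀ {i j : ℤ} (n : N.carrier) (x : E.carrier),
    n ∈ N.grading i → x ∈ S → x ∈ E.grading j → pair n x ∈ W.grading (i + j)
  chain : ∀ {i : ℤ} (n : N.carrier) (x : E.carrier), n ∈ N.grading i → x ∈ S →
    W.d (pair n x) = pair (N.d n) x + ksign i • pair n (E.d x)
  kill : ∀ n x, x ∈ Z → pair n x = 0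

/-- `P` is (up to isomorphism) the right DG `B`-module `N ⊗_B (S/Z)`:
universal property among balanced pairings. -/
structure IsTensorSubquot {A B E : DGAlgebra R} (φ : DGAlgHom A B)
    (he : EnvelopingAlg φ E) (S Z : Set E.carrier) (N P : DGModule R B) where
  pairing : TensorPairing φ he S Z N P
  univ : ∀ (W : DGModule R B) (γ : TensorPairing φ he S Z N W),
    ∃ g : DGHom P W, (∀ n x, x ∈ S → g.toFun (pairing.pair n x) = γ.pair n x) ∧
      ∀ g' : DGHom P W, (∀ n x, x ∈ S → g'.toFun (pairing.pair n x) = γ.pair n x) →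
        ∀ p, g'.toFun p = g.toFun p

/-- `Q` is (up to isomorphism) the quotient `S/Z` of DG `B^e`-submodules
`Z ⊆ S ⊆ B^e`, regarded as a right DG `B`-module via `r : B → B^e`. -/
structure SubquotModSpec {A B E : DGAlgebra R} {φ : DGAlgHom A B}
    (he : EnvelopingAlg φ E) (S Z : Set E.carrier) (Q : DGModule R B) where
  q : E.carrier → Q.carrier
  q_add : ∀ x y, x ∈ S → y ∈ S → q (x + y) = q x + q y
  q_rsmul : ∀ (r : R) x, x ∈ S → q (r • x) = r • q x
  q_mem : ∀ {i : ℤ} (x : E.carrier), x ∈ S → x ∈ E.grading i → q x ∈ Q.grading i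
  q_d : ∀ x, x ∈ S → q (E.d x) = Q.d (q x)
  q_act : ∀ (x : E.carrier) (b : B.carrier), x ∈ S →
    q (x * he.r.toFun b) = Q.smul (q x) b
  q_surj : ∀ y, ∃ x ∈ S, q x = y
  q_ker : ∀ x, x ∈ S → (q x = 0 ↔ x ∈ Z)

/-- The data exhibiting `φ : A → B` as DG quasi-smooth, relative to a realization
`E` of the enveloping DG algebra `B^e` and the multiplication map `π_B : B^e → B`:
`B` is graded-free over `A` and the diagonal ideal `J = ker π_B` carries a filtration
`J = J^[1] ⊇ J^[2] ⊇ ⋯` of DG `B^e`-submodules with `J·J^[ℓ] + J^[ℓ]·J ⊆ J^[ℓ+1]`,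
`inf J^[ℓ] ≥ ℓ`, and all subquotients `J^[ℓ]/J^[ℓ+1]` semifree over `B`. -/
structure QuasiSmoothData {A B : DGAlgebra R} (φ : DGAlgHom A B) (E : DGAlgebra R)
    (he : EnvelopingAlg φ E) (πB : DGAlgHom E B) where
  pil : ∀ b, πB.toFun (he.l.toFun b) = b
  pir : ∀ b, πB.toFun (he.r.toFun b) = b
  free : FreeOverBase φ
  filt : ℕ → Set E.carrier
  filt_one : filt 1 = {x | πB.toFun x = 0}
  filt_desc : ∀ ℓ, 1 ≤ ℓ → filt (ℓ + 1) ⊆ filt ℓ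
  filt_zero : ∀ ℓ, (0 : E.carrier) ∈ filt ℓ
  filt_add : ∀ ℓ x y, x ∈ filt ℓ → y ∈ filt ℓ → x + y ∈ filt ℓ
  filt_neg : ∀ ℓ x, x ∈ filt ℓ → -x ∈ filt ℓ
  filt_rsmul : ∀ ℓ (r : R) x, x ∈ filt ℓ → r • x ∈ filt ℓ
  filt_act : ∀ ℓ (e : E.carrier) x, x ∈ filt ℓ → x * e ∈ filt ℓ
  filt_d : ∀ ℓ x, x ∈ filt ℓ → E.d x ∈ filt ℓ
  filt_graded : ∀ ℓ x, x ∈ filt ℓ →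
    x ∈ Submodule.span R (filt ℓ ∩ ⋃ i : ℤ, (E.grading i : Set E.carrier))
  filt_mul : ∀ ℓ, 1 ≤ ℓ → ∀ a x, πB.toFun a = 0 → x ∈ filt ℓ →
    a * x ∈ filt (ℓ + 1) ∧ x * a ∈ filt (ℓ + 1)
  filt_inf : ∀ ℓ : ℕ, 1 ≤ ℓ → ∀ i : ℤ, i < (ℓ : ℤ) →
    ∀ x ∈ filt ℓ, x ∈ E.grading i → x = 0
  quot_semifree : ∀ ℓ, 1 ≤ ℓ → ∃ Q : DGModule R B,
    Nonempty (SubquotModSpec he (filt ℓ) (filt (ℓ + 1)) Q) ∧ IsSemifree Q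

/-- The data exhibiting `φ : A → B` as DG smooth: quasi-smooth, and all
subquotients `J^[ℓ]/J^[ℓ+1]` have finite semifree bases. -/
structure SmoothData {A B : DGAlgebra R} (φ : DGAlgHom A B) (E : DGAlgebra R)
    (he : EnvelopingAlg φ E) (πB : DGAlgHom E B)
    extends QuasiSmoothData φ E he πB where
  quot_finite : ∀ ℓ, 1 ≤ ℓ → ∃ Q : DGModule R B,
    Nonempty (SubquotModSpec he (filt ℓ) (filt (ℓ + 1)) Q) ∧ HasFiniteSemifreeBasis Q

/-- A DG `A`-submodule of a DG `A`-module `M`: an `R`-submodule closed under the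
`A`-action and the differential and generated by homogeneous elements. -/
structure DGSubmodule {A : DGAlgebra R} (M : DGModule R A) where
  toSubmodule : Submodule R M.carrier
  smul_mem' : ∀ (x : M.carrier) (a : A.carrier), x ∈ toSubmodule →
    M.smul x a ∈ toSubmodule
  d_mem' : ∀ x ∈ toSubmodule, M.d x ∈ toSubmodule
  graded' : ∀ x ∈ toSubmodule, x ∈ Submodule.span R
    ((toSubmodule : Set M.carrier) ∩ ⋃ i : ℤ, (M.grading i : Set M.carrier))

/-- `P` (with projections `proj`) is the direct product of the family `Ms` in the
category of DG `A`-modules. -/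
def IsDGProduct {A : DGAlgebra R} (Ms : ℕ → DGModule R A) (P : DGModule R A)
    (proj : ∀ ℓ, DGHom P (Ms ℓ)) : Prop :=
  ∀ (W : DGModule R A) (f : ∀ ℓ, DGHom W (Ms ℓ)),
    ∃ g : DGHom W P, (∀ ℓ x, (proj ℓ).toFun (g.toFun x) = (f ℓ).toFun x) ∧
      ∀ g' : DGHom W P, (∀ ℓ x, (proj ℓ).toFun (g'.toFun x) = (f ℓ).toFun x) →
        ∀ x, g'.toFun x = g.toFun x

/-- `M'` is the `k`-th shift `Σ^k M` of the DG `A`-module `M`. -/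
structure DGShiftSpec {A : DGAlgebra R} (k : ℤ) (M M' : DGModule R A) where
  toFun : M.carrier → M'.carrier
  bij : Function.Bijective toFun
  map_add : ∀ x y, toFun (x + y) = toFun x + toFun y
  map_rsmul : ∀ (r : R) x, toFun (r • x) = r • toFun x
  map_mem : ∀ {i : ℤ} (x : M.carrier), x ∈ M.grading i → toFun x ∈ M'.grading (i + k)
  map_smul : ∀ (x : M.carrier) (a : A.carrier), toFun (M.smul x a) = M'.smul (toFun x) a
  map_d : ∀ x, M'.d (toFun x) = ksign k • toFun (M.d x)

/-- `C` is the mapping cone of `f : X → Y`: a degreewise split extension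
`0 → Y → C → ΣX → 0` whose twisting term is `f`. -/
structure DGConeSpec {A : DGAlgebra R} {X Y : DGModule R A} (f : DGHom X Y)
    (C : DGModule R A) where
  inl : DGHom Y C
  inl_inj : Function.Injective inl.toFun
  pr : GradedHom C X (-1)
  pr_d : ∀ c, pr.toFun (C.d c) = - X.d (pr.toFun c)
  sec : GradedHom X C 1
  pr_sec : ∀ x, pr.toFun (sec.toFun x) = x
  pr_inl : ∀ y, pr.toFun (inl.toFun y) = 0
  split : ∀ c, ∃ y, c = inl.toFun y + sec.toFun (pr.toFun c)
  sec_d : ∀ x, C.d (sec.toFun x) = - sec.toFun (X.d x) + inl.toFun (f.toFun x)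

/-- A system of divided powers on (the homogeneous elements of positive even degree
of) a DG `R`-algebra. -/
structure DGDividedPowers (A : DGAlgebra R) where
  dpow : ℕ → A.carrier → A.carrier
  dpow_zero : ∀ {i : ℤ} (u : A.carrier), 0 < i → Even i → u ∈ A.grading i →
    dpow 0 u = 1
  dpow_one : ∀ {i : ℤ} (u : A.carrier), 0 < i → Even i → u ∈ A.grading i →
    dpow 1 u = u
  dpow_mem : ∀ {i : ℤ} (u : A.carrier) (m : ℕ), 0 < i → Even i → u ∈ A.grading i →
    dpow m u ∈ A.grading ((m : ℤ) * i)
  dpow_mul : ∀ {i : ℤ} (u : A.carrier) (m l : ℕ), 0 < i → Even i → u ∈ A.grading i →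
    dpow m u * dpow l u = ((m + l).choose m : ℤ) • dpow (m + l) u
  dpow_add : ∀ {i : ℤ} (u v : A.carrier) (m : ℕ), 0 < i → Even i →
    u ∈ A.grading i → v ∈ A.grading i →
    dpow m (u + v) = ∑ j ∈ Finset.range (m + 1), dpow j u * dpow (m - j) v
  dpow_odd_mul : ∀ {i j : ℤ} (u v : A.carrier) (m : ℕ), Odd i → Odd j →
    u ∈ A.grading i → v ∈ A.grading j → 2 ≤ m → dpow m (u * v) = 0
  dpow_even_mul : ∀ {i j : ℤ} (u v : A.carrier) (m : ℕ), Even i → Even j → 0 < j →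
    u ∈ A.grading i → v ∈ A.grading j → dpow m (u * v) = u ^ m * dpow m v
  dpow_comp : ∀ {i : ℤ} (u : A.carrier) (m l : ℕ), 0 < i → Even i →
    u ∈ A.grading i → 1 ≤ m →
    dpow l (dpow m u) =
      (Nat.factorial (m * l) / (Nat.factorial l * (Nat.factorial m) ^ l)) •
        dpow (m * l) u

/-- The index set of monomials in variables `ι` (with divided/ordinary powers):
finitely supported exponent functions, with exponents at most `1` on odd-degree
variables. -/
def MonIdx (ι : Type) (degX : ι → ℤ) : Type :=
  {m : ι →₀ ℕ // ∀ i, Odd (degX i) → m i ≤ 1}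

/-- Total weight (number of symbols) of a monomial index. -/
def monWeight {ι : Type} {degX : ι → ℤ} (m : MonIdx ι degX) : ℕ :=
  m.1.sum fun _ k => k

/-- The monomial `∏_i g i (m i)` (product taken in the increasing order of the
variables). -/
def gradMonomial {T : Type} [Ring T] {ι : Type} [LinearOrder ι] (degX : ι → ℤ)
    (g : ι → ℕ → T) (m : MonIdx ι degX) : T :=
  ((m.1.support.sort (· ≤ ·)).map fun i => g i (m.1 i)).prod

/-- `B = A[X_i : i ∈ ι]` is a polynomial extension of `A` by the variables `X_i`
of positive degrees `degX i`, adjoined in increasing order of degree, each `d X_i`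
lying in the preceding stage; the monomials in the `X_i` form a basis of `B` as a
graded `A`-module. -/
structure PolyExt {A B : DGAlgebra R} (φ : DGAlgHom A B) (ι : Type) [LinearOrder ι]
    (X : ι → B.carrier) (degX : ι → ℤ) where
  inj : Function.Injective φ.toFun
  pos_deg : ∀ i, 0 < degX i
  mono_deg : Monotone degX
  homog : ∀ i, X i ∈ B.grading (degX i)
  d_prev : ∀ i : ι, ∃ c : MonIdx ι degX →₀ A.carrier,
    (∀ m ∈ c.support, ∀ j : ι, i ≤ j → m.1 j = 0) ∧
    B.d (X i) = c.sum fun m a =>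
      gradMonomial degX (fun i' k => X i' ^ k) m * φ.toFun a
  basis : Function.Bijective (fun c : MonIdx ι degX →₀ A.carrier =>
    c.sum fun m a => gradMonomial degX (fun i' k => X i' ^ k) m * φ.toFun a)

/-- `B = A⟨X_i : i ∈ ι⟩` is a free (divided power) extension of `A` by the
variables `X_i` of positive degrees: odd variables square to zero, even variables
carry divided powers `dp i m` with `d(X^{(m)}) = X^{(m-1)} dX`, and the divided
power monomials form a basis of `B` as a graded `A`-module. -/
structure FreeExt {A B : DGAlgebra R} (φ : DGAlgHom A B) (ι : Type) [LinearOrder ι]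
    (X : ι → B.carrier) (degX : ι → ℤ) where
  inj : Function.Injective φ.toFun
  pos_deg : ∀ i, 0 < degX i
  mono_deg : Monotone degX
  homog : ∀ i, X i ∈ B.grading (degX i)
  dp : ι → ℕ → B.carrier
  dp_zero : ∀ i, dp i 0 = 1
  dp_one : ∀ i, dp i 1 = X i
  dp_odd : ∀ i m, Odd (degX i) → 2 ≤ m → dp i m = 0
  dp_mem : ∀ i (m : ℕ), dp i m ∈ B.grading ((m : ℤ) * degX i)
  dp_mul : ∀ i (m l : ℕ), dp i m * dp i l = ((m + l).choose m : ℤ) • dp i (m + l)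
  dp_d : ∀ i (m : ℕ), 1 ≤ m → B.d (dp i m) = dp i (m - 1) * B.d (X i)
  d_prev : ∀ i : ι, ∃ c : MonIdx ι degX →₀ A.carrier,
    (∀ m ∈ c.support, ∀ j : ι, i ≤ j → m.1 j = 0) ∧
    B.d (X i) = c.sum fun m a => gradMonomial degX dp m * φ.toFun a
  basis : Function.Bijective (fun c : MonIdx ι degX →₀ A.carrier =>
    c.sum fun m a => gradMonomial degX dp m * φ.toFun a)

/-- The diagonal `ξ_i = X_i^o ⊗ 1 - 1^o ⊗ X_i` of the variable `X_i` in `B^e`. -/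
def xiDiag {A B E : DGAlgebra R} {φ : DGAlgHom A B} (he : EnvelopingAlg φ E)
    {ι : Type} (X : ι → B.carrier) (i : ι) : E.carrier :=
  he.l.toFun (X i) - he.r.toFun (X i)

/-- The divided powers `ξ_i^{(m)} = Σ_{j=0}^m (-1)^{m-j} (X_i^{(j)})^o ⊗ X_i^{(m-j)}`
of the diagonal `ξ_i` in `B^e` (zero for `m ≥ 2` when `|X_i|` is odd). -/
def xiDp {A B E : DGAlgebra R} {φ : DGAlgHom A B} (he : EnvelopingAlg φ E)
    {ι : Type} (dp : ι → ℕ → B.carrier) (degX : ι → ℤ) (i : ι) (m : ℕ) :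
    E.carrier :=
  if Odd (degX i) ∧ 2 ≤ m then 0
  else ∑ j ∈ Finset.range (m + 1),
    ((-1 : ℤ) ^ (m - j)) • (he.l.toFun (dp i j) * he.r.toFun (dp i (m - j)))

/-- The monomial `ξ^{(m)} = ξ_{i_1}^{(m_{i_1})} ⋯ ξ_{i_t}^{(m_{i_t})}` in `B^e`
built from the divided powers of the diagonals. -/
def FreeExt.diagMon {A B E : DGAlgebra R} {φ : DGAlgHom A B}
    {ι : Type} [LinearOrder ι] {X : ι → B.carrier} {degX : ι → ℤ}
    (fe : FreeExt φ ι X degX) (he : EnvelopingAlg φ E) (m : MonIdx ι degX) :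
    E.carrier :=
  gradMonomial degX (xiDp he fe.dp degX) m

/-- The `ℓ`-th power `J^{(ℓ)} = Mon_{≥ℓ}(Ω)·B^e` of the diagonal ideal:
right `B^e`-linear combinations of the `ξ`-monomials of weight at least `ℓ`. -/
def FreeExt.diagPow {A B E : DGAlgebra R} {φ : DGAlgHom A B}
    {ι : Type} [LinearOrder ι] {X : ι → B.carrier} {degX : ι → ℤ}
    (fe : FreeExt φ ι X degX) (he : EnvelopingAlg φ E) (ℓ : ℕ) :
    Set E.carrier :=
  {x | ∃ c : MonIdx ι degX →₀ E.carrier, (∀ m ∈ c.support, ℓ ≤ monWeight m) ∧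
    x = c.sum fun m e => fe.diagMon he m * e}

/-- Ordinary-power analogue `J^ℓ` for polynomial extensions. -/
def PolyExt.diagPow {A B E : DGAlgebra R} {φ : DGAlgHom A B}
    {ι : Type} [LinearOrder ι] {X : ι → B.carrier} {degX : ι → ℤ}
    (_ : PolyExt φ ι X degX) (he : EnvelopingAlg φ E) (ℓ : ℕ) :
    Set E.carrier :=
  {x | ∃ c : MonIdx ι degX →₀ E.carrier, (∀ m ∈ c.support, ℓ ≤ monWeight m) ∧
    x = c.sum fun m e =>
      gradMonomial degX (fun i k => (xiDiag he X i) ^ k) m * e}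

/-- Additive closure of the set of products `a * b` with `a ∈ S₁`, `b ∈ S₂`. -/
def setMulClosure {T : Type} [Ring T] (S₁ S₂ : Set T) : Set T :=
  (AddSubmonoid.closure {x | ∃ a ∈ S₁, ∃ b ∈ S₂, x = a * b} : AddSubmonoid T)

/-- The right ideal generated by a set. -/
def rightIdealGen {T : Type} [Ring T] (S : Set T) : Set T :=
  (AddSubmonoid.closure {x | ∃ s ∈ S, ∃ e : T, x = s * e} : AddSubmonoid T)

/-- The two-sided ideal generated by a set. -/
def twoSidedGen {T : Type} [Ring T] (S : Set T) : Set T :=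
  (AddSubmonoid.closure {x | ∃ s ∈ S, ∃ e e' : T, x = e * s * e'} : AddSubmonoid T)

end

section

variable {R : Type} [CommRing R]

theorem ksign_add (i j : ℤ) : ksign (i + j) = ksign i * ksign j := by
  simp [ksign, zpow_add]

theorem ksign_neg (i : ℤ) : ksign (-i) = ksign i := by
  simp [ksign]

theorem ksign_one : ksign 1 = -1 := by
  simp [ksign]

theorem ksign_sub_one (i : ℤ) : ksign (i - 1) = -ksign i := by
  rw [sub_eq_add_neg, ksign_add, ksign_neg, ksign_one, mul_neg_one]

/-- Projections onto the homogeneous components of an internally graded module. -/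
theorem exists_homogeneous_projections {M : Type} [AddCommGroup M] [Module R M]
    (𝒢 : ℤ → Submodule R M) (hind : ∀ i : ℤ, Disjoint (𝒢 i) (⨆ j ≠ i, 𝒢 j))
    (hspan : (⨆ i, 𝒢 i) = ⊤) :
    ∃ p : ℤ → M →ₗ[R] M, (∀ i x, p i x ∈ 𝒢 i) ∧ (∀ i x, x ∈ 𝒢 i → p i x = x) ∧
      ∀ i j x, j ≠ i → x ∈ 𝒢 j → p i x = 0 := by
  classical
  have hinternal : DirectSum.IsInternal 𝒢 :=
    DirectSum.isInternal_submodule_of_iSupIndep_of_iSup_eq_top hind hspan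
  let := hinternal.chooseDecomposition
  refine ⟨fun i => (𝒢 i).subtype ∘ₗ DirectSum.component R ℤ (fun i => 𝒢 i) i ∘ₗ
    (DirectSum.decomposeLinearEquiv 𝒢).toLinearMap, fun i x => Subtype.prop _, ?_, ?_⟩
  · intro i x hx
    exact DirectSum.decompose_of_mem_same 𝒢 hx
  · intro i j x hij hx
    exact DirectSum.decompose_of_mem_ne 𝒢 hx hij

namespace DGModule

variable {A : DGAlgebra R}

/-- The differential as a linear map. -/
def dLin (M : DGModule R A) : M.carrier →ₗ[R] M.carrier where
  toFun := M.d
  map_add' := M.d_add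
  map_smul' := M.d_rsmul

/-- The action on a fixed element as a linear map. -/
def smulLin (M : DGModule R A) (m : M.carrier) : A.carrier →ₗ[R] M.carrier where
  toFun := M.smul m
  map_add' := M.smul_add m
  map_smul' r a := M.smul_rsmul r m a

/-- The action of a fixed algebra element as a linear map. -/
def actLin (M : DGModule R A) (a : A.carrier) : M.carrier →ₗ[R] M.carrier where
  toFun m := M.smul m a
  map_add' m n := M.add_smul m n a
  map_smul' r m := M.rsmul_smul r m a

@[simp] theorem dLin_apply (M : DGModule R A) (x : M.carrier) : M.dLin x = M.d x := rfl

@[simp] theorem smulLin_apply (M : DGModule R A) (m : M.carrier) (a : A.carrier) :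
    M.smulLin m a = M.smul m a := rfl

@[simp] theorem actLin_apply (M : DGModule R A) (m : M.carrier) (a : A.carrier) :
    M.actLin a m = M.smul m a := rfl

/-- A property stable under addition holds everywhere if it holds on homogeneous elements. -/
theorem homogeneous_induction (M : DGModule R A) {C : M.carrier → Prop}
    (mem : ∀ i, ∀ x ∈ M.grading i, C x) (add : ∀ x y, C x → C y → C (x + y))
    (x : M.carrier) : C x :=
  Submodule.iSup_induction M.grading (motive := C) (M.spanning ▸ Submodule.mem_top) mem
    (mem 0 0 (Submodule.zero_mem _)) add

end DGModule

theorem DGAlgebra.homogeneous_induction (A : DGAlgebra R)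
    {C : A.carrier → Prop} (mem : ∀ i, ∀ x ∈ A.grading i, C x)
    (add : ∀ x y, C x → C y → C (x + y)) (x : A.carrier) : C x :=
  Submodule.iSup_induction A.grading (motive := C) (A.spanning ▸ Submodule.mem_top) mem
    (mem 0 0 (Submodule.zero_mem _)) add

namespace GradedHom

variable {A : DGAlgebra R} {M N : DGModule R A} {k : ℤ}

/-- A graded homomorphism as a linear map. -/
def lin (f : GradedHom M N k) : M.carrier →ₗ[R] N.carrier where
  toFun := f.toFun
  map_add' := f.map_add
  map_smul' := f.map_rsmul

@[simp] theorem lin_apply (f : GradedHom M N k) (x : M.carrier) : f.lin x = f.toFun x := rfl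

/-- The differential `f ↦ ∂ f - (-1)^{|f|} f ∂` of the Hom complex. -/
def delta (f : GradedHom M N k) : GradedHom M N (k - 1) where
  toFun x := N.d (f.toFun x) - ksign k • f.toFun (M.d x)
  map_add x y := by
    simp only [f.map_add, N.d_add, M.d_add, smul_add]
    abel
  map_rsmul r x := by
    simp only [f.map_rsmul, N.d_rsmul, M.d_rsmul, smul_sub, smul_comm r]
  map_smul x a := by
    induction x using M.homogeneous_induction with
    | mem i x hx =>
      have e : f.toFun (M.d (M.smul x a)) =
          N.smul (f.toFun (M.d x)) a + ksign i • N.smul (f.toFun x) (A.d a) := by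
        rw [M.leibniz x a hx, f.map_add, f.map_smul, ← f.lin_apply (_ • _), map_zsmul,
          f.lin_apply, f.map_smul]
      rw [f.map_smul, N.leibniz _ a (f.map_mem hx), e, ← N.actLin_apply (_ - _), map_sub,
        map_zsmul, N.actLin_apply, N.actLin_apply, ksign_add, smul_add, smul_smul,
        mul_comm (ksign k)]
      abel
    | add x y hx hy =>
      have e : ∀ u v w z : N.carrier, N.d (u + v) - ksign k • (w + z) =
          (N.d u - ksign k • w) + (N.d v - ksign k • z) := by
        intro u v w z
        rw [N.d_add, smul_add]
        abel
      rw [M.add_smul, f.map_add, M.d_add, f.map_add, e, hx, hy, f.map_add, M.d_add, f.map_add, e,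
        N.add_smul]
  map_mem {i x} hx := by
    refine Submodule.sub_mem _ ?_ (zsmul_mem ?_ _)
    · have := N.d_mem (f.map_mem hx)
      rwa [add_sub_assoc] at this
    · have := f.map_mem (M.d_mem hx)
      rwa [show i - 1 + k = i + (k - 1) by ring] at this

theorem delta_apply (f : GradedHom M N k) (x : M.carrier) :
    f.delta.toFun x = N.d (f.toFun x) - ksign k • f.toFun (M.d x) := rfl

/-- Reindexing along an equality of degrees. -/
def cast {l : ℤ} (h : k = l) (f : GradedHom M N k) : GradedHom M N l where
  toFun := f.toFun
  map_add := f.map_add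
  map_rsmul := f.map_rsmul
  map_smul := f.map_smul
  map_mem := h ▸ f.map_mem

/-- The difference of two graded homomorphisms of the same degree. -/
def sub (f g : GradedHom M N k) : GradedHom M N k where
  toFun x := f.toFun x - g.toFun x
  map_add x y := by
    rw [f.map_add, g.map_add]
    abel
  map_rsmul r x := by rw [f.map_rsmul, g.map_rsmul, smul_sub]
  map_smul x a := by
    rw [f.map_smul, g.map_smul, ← N.actLin_apply (_ - _), map_sub]
    rfl
  map_mem hx := Submodule.sub_mem _ (f.map_mem hx) (g.map_mem hx)

end GradedHom

/-- The composite of a graded homomorphism with a DG homomorphism. -/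
def DGHom.compGraded {A : DGAlgebra R} {M N W : DGModule R A} {k : ℤ}
    (q : DGHom N W) (f : GradedHom M N k) : GradedHom M W k where
  toFun x := q.toFun (f.toFun x)
  map_add x y := by rw [f.map_add, q.map_add]
  map_rsmul r x := by rw [f.map_rsmul, q.map_rsmul]
  map_smul x a := by rw [f.map_smul, q.map_smul]
  map_mem hx := q.map_mem (f.map_mem hx)

/-- A DG homomorphism as a linear map. -/
def DGHom.lin {A : DGAlgebra R} {M N : DGModule R A}
    (q : DGHom M N) : M.carrier →ₗ[R] N.carrier where
  toFun := q.toFun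
  map_add' := q.map_add
  map_smul' := q.map_rsmul

@[simp] theorem DGHom.lin_apply {A : DGAlgebra R} {M N : DGModule R A}
    (q : DGHom M N) (x : M.carrier) : q.lin x = q.toFun x := rfl

namespace SemifreeBasisOn

variable {A : DGAlgebra R} {N P : DGModule R A} {κ : Type}
  {e : κ → N.carrier}

/-- The coordinates with respect to a semifree basis. -/
noncomputable def repr (s : SemifreeBasisOn N e) : N.carrier ≃ₗ[R] (κ →₀ A.carrier) :=
  (LinearEquiv.ofBijective (Finsupp.lsum R fun k => N.smulLin (e k)) s.basis).symm

theorem repr_symm_apply (s : SemifreeBasisOn N e) (c : κ →₀ A.carrier) :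
    s.repr.symm c = c.sum fun k a => N.smul (e k) a := rfl

theorem repr_smul (s : SemifreeBasisOn N e) (x : N.carrier) (a : A.carrier) :
    s.repr (N.smul x a) = Finsupp.mapRange.linearMap (LinearMap.mulRight R a) (s.repr x) := by
  rw [← LinearEquiv.eq_symm_apply]
  obtain ⟨c, rfl⟩ := s.repr.symm.surjective x
  rw [LinearEquiv.apply_symm_apply]
  induction c using Finsupp.induction_linear with
  | zero =>
    rw [map_zero, map_zero, map_zero]
    exact map_zero (N.actLin a)
  | add c c' hc hc' => rw [map_add, N.add_smul, hc, hc', map_add, map_add]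
  | single k b =>
    simp only [repr_symm_apply, Finsupp.mapRange.linearMap_apply, Finsupp.mapRange_single]
    rw [Finsupp.sum_single_index (h := fun k a => N.smul (e k) a) (map_zero (N.smulLin (e k))),
      Finsupp.sum_single_index (h := fun k a => N.smul (e k) a) (map_zero (N.smulLin (e k))),
      N.smul_mul]
    rfl

theorem repr_mem (s : SemifreeBasisOn N e) {i : ℤ} {x : N.carrier} (hx : x ∈ N.grading i)
    (k : κ) : s.repr x k ∈ A.grading (i - s.deg k) := by
  obtain ⟨pA, pA_mem, pA_same, pA_ne⟩ :=
    exists_homogeneous_projections A.grading A.indep A.spanning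
  obtain ⟨pN, -, pN_same, pN_ne⟩ :=
    exists_homogeneous_projections N.grading N.indep N.spanning
  have key : ∀ j a, pN i (N.smul (e j) a) = N.smul (e j) (pA (i - s.deg j) a) := by
    intro j a
    induction a using A.homogeneous_induction with
    | mem l a ha =>
      by_cases h : l = i - s.deg j
      · subst h
        rw [pA_same _ _ ha]
        refine pN_same _ _ ?_
        have := N.smul_mem (s.homog j) ha
        rwa [add_sub_cancel] at this
      · rw [pA_ne _ _ _ h ha, pN_ne i (s.deg j + l) _ (by omega) (N.smul_mem (s.homog j) ha)]
        exact (map_zero (N.smulLin (e j))).symm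
    | add a b ha hb => rw [N.smul_add, map_add, ha, hb, map_add, N.smul_add]
  have hrepr : Finsupp.onFinset (s.repr x).support
      (fun j => pA (i - s.deg j) (s.repr x j)) (fun j hj => by
        rw [Finsupp.mem_support_iff]
        rintro h
        exact hj (by rw [h, map_zero])) = s.repr x := by
    apply s.repr.symm.injective
    rw [LinearEquiv.symm_apply_apply, repr_symm_apply,
      Finsupp.onFinset_sum (g := fun j a => N.smul (e j) a) _ (fun j => map_zero (N.smulLin (e j)))]
    simp only [← key]
    rw [← map_sum]
    have hsum : ∑ j ∈ (s.repr x).support, N.smul (e j) (s.repr x j) = x :=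
      s.repr.symm_apply_apply x
    rw [hsum, pN_same _ _ hx]
  rw [← hrepr]
  exact pA_mem _ _

/-- The graded homomorphism with prescribed homogeneous values on a semifree basis. -/
noncomputable def extend (s : SemifreeBasisOn N e) {m : ℤ} (p : κ → P.carrier)
    (hp : ∀ k, p k ∈ P.grading (s.deg k + m)) : GradedHom N P m where
  toFun x := Finsupp.lsum R (fun k => P.smulLin (p k)) (s.repr x)
  map_add x y := by rw [map_add, map_add]
  map_rsmul r x := by rw [map_smul, map_smul]
  map_smul x a := by
    rw [s.repr_smul]
    generalize s.repr x = c
    induction c using Finsupp.induction_linear with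
    | zero =>
      rw [map_zero, map_zero]
      exact (map_zero (P.actLin a)).symm
    | add c c' hc hc' => rw [map_add, map_add, map_add, P.add_smul, hc, hc']
    | single k b =>
      rw [Finsupp.mapRange.linearMap_apply, Finsupp.mapRange_single, Finsupp.lsum_single,
        Finsupp.lsum_single]
      exact (P.smul_mul (p k) b a).symm
  map_mem {i x} hx := by
    refine Submodule.sum_mem _ fun k _ => ?_
    have := P.smul_mem (hp k) (s.repr_mem hx k)
    rwa [show s.deg k + m + (i - s.deg k) = i + m by ring] at this

theorem extend_apply (s : SemifreeBasisOn N e) {m : ℤ} (p : κ → P.carrier)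
    (hp : ∀ k, p k ∈ P.grading (s.deg k + m)) (x : N.carrier) :
    (s.extend p hp).toFun x = (s.repr x).sum fun k a => P.smul (p k) a := rfl

/-- Graded homomorphisms from a semifree DG module lift along degreewise surjections. -/
theorem exists_lift (s : SemifreeBasisOn N e) {Q : DGModule R A} (q : DGHom P Q)
    (hq : ∀ i, ∀ y ∈ Q.grading i, ∃ x ∈ P.grading i, q.toFun x = y) {m : ℤ}
    (g : GradedHom N Q m) : ∃ f : GradedHom N P m, ∀ x, q.toFun (f.toFun x) = g.toFun x := by
  choose p hp hpq using fun k => hq _ _ (g.map_mem (s.homog k))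
  refine ⟨s.extend p hp, fun x => ?_⟩
  have hx : x = (s.repr x).sum fun k a => N.smul (e k) a := (s.repr.symm_apply_apply x).symm
  conv_rhs => rw [hx]
  rw [extend_apply, ← q.lin_apply, ← g.lin_apply, map_finsuppSum, map_finsuppSum]
  simp only [q.lin_apply, g.lin_apply, q.map_smul, g.map_smul, hpq]

end SemifreeBasisOn

namespace DGSubmodule

variable {A : DGAlgebra R} {M : DGModule R A}

theorem proj_mem (K : DGSubmodule M) {p : ℤ → M.carrier →ₗ[R] M.carrier}
    (hsame : ∀ i x, x ∈ M.grading i → p i x = x)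
    (hne : ∀ i j x, j ≠ i → x ∈ M.grading j → p i x = 0) (i : ℤ) {x : M.carrier}
    (hx : x ∈ K.toSubmodule) : p i x ∈ K.toSubmodule := by
  have h : Submodule.span R
      ((K.toSubmodule : Set M.carrier) ∩ ⋃ i : ℤ, (M.grading i : Set M.carrier)) ≤
      K.toSubmodule.comap (p i) := by
    rw [Submodule.span_le]
    rintro y ⟨hyK, hy⟩
    obtain ⟨j, hj⟩ := Set.mem_iUnion.mp hy
    by_cases h : j = i
    · subst h
      simpa [hsame j y hj] using hyK
    · simp [hne i j y h hj]
  exact h (K.graded' x hx)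

/-- The quotient of a DG module by a DG submodule. -/
def quotient (K : DGSubmodule M) : DGModule R A where
  carrier := M.carrier ⧸ K.toSubmodule
  grading i := (M.grading i).map K.toSubmodule.mkQ
  indep i := by
    obtain ⟨p, -, hsame, hne⟩ := exists_homogeneous_projections M.grading M.indep M.spanning
    rw [Submodule.disjoint_def]
    rintro _ ⟨x, hx, rfl⟩ hy
    simp only [← Submodule.map_iSup] at hy
    obtain ⟨x', hx', e⟩ := hy
    have h0 : p i x' = 0 := by
      have : (⨆ j ≠ i, M.grading j) ≤ LinearMap.ker (p i) :=
        iSup₂_le fun j hj y hy => hne i j y hj hy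
      exact this hx'
    have h1 : x - x' ∈ K.toSubmodule := (Submodule.Quotient.eq _).mp e.symm
    have h2 := K.proj_mem hsame hne i h1
    rw [map_sub, h0, sub_zero, hsame i x hx] at h2
    exact (Submodule.Quotient.mk_eq_zero _).mpr h2
  spanning := by
    rw [← Submodule.map_iSup, M.spanning, Submodule.map_top, Submodule.range_mkQ]
  smul y a := K.toSubmodule.mapQ K.toSubmodule (M.actLin a)
    (fun x hx => K.smul_mem' x a hx) y
  smul_add := by
    rintro ⟨m⟩ a b
    exact congrArg _ (M.smul_add m a b)
  add_smul m n a := map_add _ m n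
  smul_rsmul := by
    rintro r ⟨m⟩ a
    exact congrArg _ (M.smul_rsmul r m a)
  rsmul_smul r m a := map_smul _ r m
  smul_one := by
    rintro ⟨m⟩
    exact congrArg _ (M.smul_one m)
  smul_mul := by
    rintro ⟨m⟩ a b
    exact congrArg _ (M.smul_mul m a b)
  smul_mem := by
    rintro i j _ a ⟨m, hm, rfl⟩ ha
    exact ⟨M.smul m a, M.smul_mem hm ha, rfl⟩
  d := K.toSubmodule.mapQ K.toSubmodule M.dLin K.d_mem'
  d_add := map_add _
  d_rsmul := map_smul _
  d_mem := by
    rintro i _ ⟨m, hm, rfl⟩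
    exact ⟨M.d m, M.d_mem hm, rfl⟩
  d_sq := by
    rintro ⟨m⟩
    exact congrArg K.toSubmodule.mkQ (M.d_sq m)
  leibniz := by
    rintro i _ a ⟨m, hm, rfl⟩
    exact (congrArg K.toSubmodule.mkQ (M.leibniz m a hm)).trans
      ((map_add _ _ _).trans (congrArg _ (map_zsmul _ _ _)))

/-- The quotient map by a DG submodule. -/
def mkHom (K : DGSubmodule M) : DGHom M K.quotient where
  toFun := K.toSubmodule.mkQ
  map_add := map_add _
  map_rsmul := map_smul _
  map_smul _ _ := rfl
  map_mem hx := ⟨_, hx, rfl⟩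
  comm_d _ := rfl

theorem mkHom_surjective (K : DGSubmodule M) : Function.Surjective K.mkHom.toFun :=
  K.toSubmodule.mkQ_surjective

theorem mkHom_eq_zero (K : DGSubmodule M) {x : M.carrier} :
    K.mkHom.toFun x = 0 ↔ x ∈ K.toSubmodule :=
  Submodule.Quotient.mk_eq_zero _

theorem exists_mkHom_eq_of_mem (K : DGSubmodule M) (i : ℤ) (y : K.quotient.carrier)
    (hy : y ∈ K.quotient.grading i) : ∃ x ∈ M.grading i, K.mkHom.toFun x = y := hy

/-- A DG homomorphism vanishing on a DG submodule factors through the quotient. -/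
def desc (K : DGSubmodule M) {W : DGModule R A} (g : DGHom M W)
    (hg : ∀ x ∈ K.toSubmodule, g.toFun x = 0) : DGHom K.quotient W where
  toFun := K.toSubmodule.liftQ g.lin hg
  map_add := map_add _
  map_rsmul := map_smul _
  map_smul := by
    rintro ⟨x⟩ a
    exact g.map_smul x a
  map_mem := by
    rintro i _ ⟨x, hx, rfl⟩
    exact g.map_mem hx
  comm_d := by
    rintro ⟨x⟩
    exact g.comm_d x

theorem desc_mkHomHomHom (K : DGSubmodule M) {W : DGModule R A} (g : DGHom M W)
    (hg : ∀ x ∈ K.toSubmodule, g.toFun x = 0) (x : M.carrier) :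
    (K.desc g hg).toFun (K.mkHom.toFun x) = g.toFun x := rfl

end DGSubmodule

section MilnorSequence

variable {A : DGAlgebra R} {N P : DGModule R A}

/-- If `Ext^k(N, P/K) = 0` with `N` semifree, a cocycle modulo `K` is a coboundary modulo `K`. -/
theorem ExtVanish.exists_primitive_mod {k : ℤ} {K : DGSubmodule P} (hN : IsSemifree N)
    (hext : ExtVanish k N K.quotient) (f : GradedHom N P (-k))
    (hf : ∀ x, P.d (f.toFun x) - ksign k • f.toFun (N.d x) ∈ K.toSubmodule) :
    ∃ h : GradedHom N P (-k + 1), ∀ x,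
      f.toFun x - (P.d (h.toFun x) + ksign k • h.toFun (N.d x)) ∈ K.toSubmodule := by
  obtain ⟨κ, e, ⟨s⟩⟩ := hN
  obtain ⟨g, hg⟩ := hext (K.mkHom.compGraded f) (fun x => by
    have := K.mkHom_eq_zero.mpr (hf x)
    rw [← K.mkHom.lin_apply, map_sub, map_zsmul, sub_eq_zero, K.mkHom.lin_apply,
      K.mkHom.comm_d] at this
    exact this)
  obtain ⟨h, hh⟩ := s.exists_lift K.mkHom K.exists_mkHom_eq_of_mem g
  refine ⟨h, fun x => K.mkHom_eq_zero.mp ?_⟩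
  rw [← K.mkHom.lin_apply, map_sub, map_add, map_zsmul, sub_eq_zero]
  simp only [K.mkHom.lin_apply, K.mkHom.comm_d, hh]
  exact hg x

/-- Vanishing of `Ext^k(N, P)` from vanishing of `Ext^k` and `Ext^{k-1}` into the quotients of `P`
by a decreasing sequence of DG submodules which is degreewise eventually zero. -/
theorem ExtVanish.of_quotients {k : ℤ} (hN : IsSemifree N) (K : ℕ → DGSubmodule P)
    (hanti : ∀ ℓ, (K (ℓ + 1)).toSubmodule ≤ (K ℓ).toSubmodule)
    (hsep : ∀ i : ℤ, ∃ L, ∀ ℓ, L ≤ ℓ → ∀ x ∈ (K ℓ).toSubmodule, x ∈ P.grading i → x = 0)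
    (hk : ∀ ℓ, ExtVanish k N (K ℓ).quotient)
    (hk' : ∀ ℓ, ExtVanish (k - 1) N (K ℓ).quotient) : ExtVanish k N P := by
  intro f hf
  have hlift : ∀ ℓ, ∃ h : GradedHom N P (-k + 1), ∀ x,
      f.toFun x - (P.d (h.toFun x) + ksign k • h.toFun (N.d x)) ∈ (K ℓ).toSubmodule :=
    fun ℓ => (hk ℓ).exists_primitive_mod hN f fun x => by
      rw [hf x, sub_self]
      exact Submodule.zero_mem _
  have hstep : ∀ (ℓ : ℕ) (h : GradedHom N P (-k + 1)),
      (∀ x, f.toFun x - (P.d (h.toFun x) + ksign k • h.toFun (N.d x)) ∈ (K ℓ).toSubmodule) →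
      ∃ h' : GradedHom N P (-k + 1),
        (∀ x, f.toFun x - (P.d (h'.toFun x) + ksign k • h'.toFun (N.d x)) ∈
          (K (ℓ + 1)).toSubmodule) ∧
        ∀ x, h'.toFun x - h.toFun x ∈ (K ℓ).toSubmodule := by
    intro ℓ h hh
    obtain ⟨g, hg⟩ := hlift (ℓ + 1)
    obtain ⟨u, hu⟩ := (hk' ℓ).exists_primitive_mod hN ((g.sub h).cast (by ring)) (fun x => by
      have := Submodule.sub_mem _ (hh x) (hanti ℓ (hg x))
      convert this using 1
      change P.dLin (g.toFun x - h.toFun x) -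
        ksign (k - 1) • (g.toFun (N.d x) - h.toFun (N.d x)) = _
      rw [map_sub, ksign_sub_one, P.dLin_apply, P.dLin_apply, neg_smul, smul_sub]
      abel)
    have hdelta : ∀ x, u.delta.toFun x = P.d (u.toFun x) + ksign (k - 1) • u.toFun (N.d x) := by
      intro x
      rw [u.delta_apply, ksign_add, ksign_neg, ksign_one, mul_neg_one, neg_smul, sub_neg_eq_add]
    refine ⟨g.sub (u.delta.cast (by ring)), fun x => ?_, fun x => ?_⟩
    · convert hg x using 2
      change P.dLin (g.toFun x - u.delta.toFun x) +
        ksign k • (g.toFun (N.d x) - u.delta.toFun (N.d x)) = _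
      have h1 : u.toFun (N.d (N.d x)) = 0 := by
        rw [N.d_sq]
        exact map_zero u.lin
      rw [hdelta, hdelta, h1, smul_zero, add_zero, map_sub, map_add, map_zsmul, ksign_sub_one]
      simp only [P.dLin_apply, P.d_sq, neg_smul, smul_sub]
      abel
    · have := hu x
      rw [← hdelta] at this
      convert this using 1
      change g.toFun x - u.delta.toFun x - h.toFun x = g.toFun x - h.toFun x - u.delta.toFun x
      abel
  choose next hnext hdiff using hstep
  let s : ∀ ℓ : ℕ, {h : GradedHom N P (-k + 1) // ∀ x,
      f.toFun x - (P.d (h.toFun x) + ksign k • h.toFun (N.d x)) ∈ (K ℓ).toSubmodule} :=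
    fun ℓ => Nat.rec ⟨(hlift 0).choose, (hlift 0).choose_spec⟩
      (fun ℓ h => ⟨next ℓ h.1 h.2, hnext ℓ h.1 h.2⟩) ℓ
  have hs : ∀ ℓ x, (s (ℓ + 1)).1.toFun x - (s ℓ).1.toFun x ∈ (K ℓ).toSubmodule :=
    fun ℓ => hdiff ℓ (s ℓ).1 (s ℓ).2
  have hlim : ∀ x, ∃ y, ∀ᶠ ℓ in Filter.atTop, (s ℓ).1.toFun x = y := by
    intro x
    induction x using N.homogeneous_induction with
    | mem i x hx =>
      obtain ⟨L, hL⟩ := hsep (i + (-k + 1))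
      refine ⟨(s L).1.toFun x, Filter.eventually_atTop.mpr ⟨L, fun ℓ hℓ => ?_⟩⟩
      induction ℓ, hℓ using Nat.le_induction with
      | base => rfl
      | succ ℓ hℓ ih =>
        rw [← ih, ← sub_eq_zero]
        exact hL ℓ hℓ _ (hs ℓ x)
          (Submodule.sub_mem _ ((s (ℓ + 1)).1.map_mem hx) ((s ℓ).1.map_mem hx))
    | add x x' hx hx' =>
      obtain ⟨y, hy⟩ := hx
      obtain ⟨y', hy'⟩ := hx'
      refine ⟨y + y', ?_⟩
      filter_upwards [hy, hy'] with ℓ h h'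
      rw [GradedHom.map_add, h, h']
  choose h hh using hlim
  let H : GradedHom N P (-k + 1) :=
    { toFun := h
      map_add := fun x y => by
        obtain ⟨ℓ, h1, h2, h3⟩ := ((hh (x + y)).and ((hh x).and (hh y))).exists
        rw [← h1, ← h2, ← h3, GradedHom.map_add]
      map_rsmul := fun r x => by
        obtain ⟨ℓ, h1, h2⟩ := ((hh (r • x)).and (hh x)).exists
        rw [← h1, ← h2, GradedHom.map_rsmul]
      map_smul := fun x a => by
        obtain ⟨ℓ, h1, h2⟩ := ((hh (N.smul x a)).and (hh x)).exists
        rw [← h1, ← h2, GradedHom.map_smul]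
      map_mem := fun {i x} hx => by
        obtain ⟨ℓ, h1⟩ := (hh x).exists
        rw [← h1]
        exact (s ℓ).1.map_mem hx }
  refine ⟨H, fun x => ?_⟩
  change f.toFun x = P.d (h x) + ksign k • h (N.d x)
  induction x using N.homogeneous_induction with
  | mem i x hx =>
    obtain ⟨L, hL⟩ := hsep (i + -k)
    obtain ⟨ℓ, hℓ, h1, h2⟩ :=
      ((Filter.eventually_ge_atTop L).and ((hh x).and (hh (N.d x)))).exists
    rw [← sub_eq_zero]
    refine hL ℓ hℓ _ (by rw [← h1, ← h2]; exact (s ℓ).2 x) ?_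
    refine Submodule.sub_mem _ (f.map_mem hx) (Submodule.add_mem _ ?_ (zsmul_mem ?_ _))
    · have := P.d_mem (H.map_mem hx)
      rwa [show i + (-k + 1) - 1 = i + -k by ring] at this
    · have := H.map_mem (N.d_mem hx)
      rwa [show i - 1 + (-k + 1) = i + -k by ring] at this
  | add x y hx hy =>
    have e : ∀ x y, h (x + y) = h x + h y := H.map_add
    rw [f.map_add, hx, hy, e, N.d_add, e, P.d_add, smul_add]
    abel

end MilnorSequence

namespace QuasiSmoothData

variable {A B E : DGAlgebra R} {φ : DGAlgHom A B}
  {he : EnvelopingAlg φ E} {πB : DGAlgHom E B}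

theorem filt_subset_filt_one (qs : QuasiSmoothData φ E he πB) {ℓ : ℕ} (hℓ : 1 ≤ ℓ) :
    qs.filt ℓ ⊆ qs.filt 1 := by
  induction ℓ, hℓ using Nat.le_induction with
  | base => exact subset_rfl
  | succ ℓ hℓ ih => exact (qs.filt_desc ℓ hℓ).trans ih

variable {N P : DGModule R B}

/-- The span in `N ⊗_B J` of the homogeneous tensors `n ⊗ x` with `x ∈ J^[ℓ]`. -/
def tensorFilt (qs : QuasiSmoothData φ E he πB)
    (t : TensorPairing φ he (qs.filt 1) ∅ N P) (ℓ : ℕ) : Submodule R P.carrier :=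
  Submodule.span R {p | ∃ (i j : ℤ) (n : N.carrier) (x : E.carrier),
    n ∈ N.grading i ∧ x ∈ E.grading j ∧ x ∈ qs.filt ℓ ∧ p = t.pair n x}

theorem pair_mem_tensorFilt (qs : QuasiSmoothData φ E he πB)
    (t : TensorPairing φ he (qs.filt 1) ∅ N P) {ℓ : ℕ} (hℓ : 1 ≤ ℓ) (n : N.carrier)
    {x : E.carrier} (hx : x ∈ qs.filt ℓ) : t.pair n x ∈ qs.tensorFilt t ℓ := by
  have hsub := qs.filt_subset_filt_one hℓ
  induction n using N.homogeneous_induction with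
  | mem i n hn =>
    refine (?_ : x ∈ qs.filt 1 ∧ t.pair n x ∈ qs.tensorFilt t ℓ).2
    refine Submodule.span_induction
      (p := fun x _ => x ∈ qs.filt 1 ∧ t.pair n x ∈ qs.tensorFilt t ℓ)
      ?_ ?_ ?_ ?_ (qs.filt_graded ℓ x hx)
    · rintro y ⟨hy, hy'⟩
      obtain ⟨j, hj⟩ := Set.mem_iUnion.mp hy'
      exact ⟨hsub hy, Submodule.subset_span ⟨i, j, n, y, hn, hj, hy, rfl⟩⟩
    · exact ⟨qs.filt_zero 1, Submodule.subset_span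
        ⟨i, 0, n, 0, hn, Submodule.zero_mem _, qs.filt_zero ℓ, rfl⟩⟩
    · rintro y z - - ⟨hy, hy'⟩ ⟨hz, hz'⟩
      refine ⟨qs.filt_add 1 _ _ hy hz, ?_⟩
      rw [t.add_right n y z hy hz]
      exact Submodule.add_mem _ hy' hz'
    · rintro r y - ⟨hy, hy'⟩
      refine ⟨qs.filt_rsmul 1 r _ hy, ?_⟩
      rw [t.rsmul_right r n y hy]
      exact Submodule.smul_mem _ _ hy'
  | add n n' hn hn' =>
    rw [t.add_left n n' x (hsub hx)]
    exact Submodule.add_mem _ hn hn'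

theorem tensorFilt_succ_le (qs : QuasiSmoothData φ E he πB)
    (t : TensorPairing φ he (qs.filt 1) ∅ N P) {ℓ : ℕ} (hℓ : 1 ≤ ℓ) :
    qs.tensorFilt t (ℓ + 1) ≤ qs.tensorFilt t ℓ := by
  refine Submodule.span_mono ?_
  rintro p ⟨i, j, n, x, hn, hx, hxℓ, rfl⟩
  exact ⟨i, j, n, x, hn, hx, qs.filt_desc ℓ hℓ hxℓ, rfl⟩

/-- The image of `N ⊗_B J^[ℓ]` in `N ⊗_B J`. -/
def tensorSubmodule (qs : QuasiSmoothData φ E he πB)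
    (t : TensorPairing φ he (qs.filt 1) ∅ N P) {ℓ : ℕ} (hℓ : 1 ≤ ℓ) : DGSubmodule P where
  toSubmodule := qs.tensorFilt t ℓ
  smul_mem' p b hp := by
    have h : qs.tensorFilt t ℓ ≤ (qs.tensorFilt t ℓ).comap (P.actLin b) := by
      refine Submodule.span_le.mpr ?_
      rintro _ ⟨i, j, n, x, hn, hx, hxℓ, rfl⟩
      change P.smul (t.pair n x) b ∈ qs.tensorFilt t ℓ
      rw [← t.act_right n b x (qs.filt_subset_filt_one hℓ hxℓ)]
      exact qs.pair_mem_tensorFilt t hℓ n (qs.filt_act ℓ _ x hxℓ)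
    exact h hp
  d_mem' p hp := by
    have h : qs.tensorFilt t ℓ ≤ (qs.tensorFilt t ℓ).comap P.dLin := by
      refine Submodule.span_le.mpr ?_
      rintro _ ⟨i, j, n, x, hn, hx, hxℓ, rfl⟩
      change P.d (t.pair n x) ∈ qs.tensorFilt t ℓ
      rw [t.chain n x hn (qs.filt_subset_filt_one hℓ hxℓ)]
      exact Submodule.add_mem _ (qs.pair_mem_tensorFilt t hℓ _ hxℓ)
        (zsmul_mem (qs.pair_mem_tensorFilt t hℓ _ (qs.filt_d ℓ x hxℓ)) _)
    exact h hp
  graded' p hp := by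
    refine Submodule.span_mono ?_ hp
    rintro _ ⟨i, j, n, x, hn, hx, hxℓ, rfl⟩
    exact ⟨qs.pair_mem_tensorFilt t hℓ n hxℓ, Set.mem_iUnion.mpr
      ⟨i + j, t.grade n x hn (qs.filt_subset_filt_one hℓ hxℓ) hx⟩⟩

theorem eq_zero_of_mem_tensorFilt (qs : QuasiSmoothData φ E he πB)
    (t : TensorPairing φ he (qs.filt 1) ∅ N P) {ℓ : ℕ} (hℓ : 1 ≤ ℓ) {n₀ : ℤ}
    (hn₀ : ∀ i : ℤ, i < n₀ → N.grading i = ⊥) {i : ℤ} (hi : i < n₀ + ℓ) {p : P.carrier}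
    (hp : p ∈ qs.tensorFilt t ℓ) (hpi : p ∈ P.grading i) : p = 0 := by
  obtain ⟨q, -, hsame, hne⟩ := exists_homogeneous_projections P.grading P.indep P.spanning
  have h : qs.tensorFilt t ℓ ≤ LinearMap.ker (q i) := by
    refine Submodule.span_le.mpr ?_
    rintro _ ⟨a, b, n, x, hn, hx, hxℓ, rfl⟩
    have hx1 := qs.filt_subset_filt_one hℓ hxℓ
    change q i (t.pair n x) = 0
    by_cases ha : a < n₀
    · rw [hn₀ a ha, Submodule.mem_bot] at hn
      have := t.rsmul_left 0 n x hx1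
      rw [zero_smul, zero_smul] at this
      rw [hn, this, map_zero]
    · by_cases hb : b < ℓ
      · have hx0 := qs.filt_inf ℓ hℓ b hb x hxℓ hx
        have := t.rsmul_right 0 n x hx1
        rw [zero_smul, zero_smul] at this
        rw [hx0, this, map_zero]
      · exact hne i (a + b) _ (by omega) (t.grade n x hn hx1 hx)
  rw [← hsame i p hpi]
  exact h hp

/-- The quotient of `N ⊗_B J` by the image of `N ⊗_B J^[ℓ]` is `N ⊗_B J/J^[ℓ]`. -/
def quotientIsTensor (qs : QuasiSmoothData φ E he πB)
    (T : IsTensorSubquot φ he (qs.filt 1) ∅ N P) {ℓ : ℕ} (hℓ : 1 ≤ ℓ) :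
    IsTensorSubquot φ he (qs.filt 1) (qs.filt ℓ) N
      (qs.tensorSubmodule T.pairing hℓ).quotient where
  pairing :=
    { pair := fun n x => (qs.tensorSubmodule T.pairing hℓ).mkHom.toFun (T.pairing.pair n x)
      add_left := fun n n' x hx => by rw [T.pairing.add_left n n' x hx, DGHom.map_add]
      add_right := fun n x y hx hy => by rw [T.pairing.add_right n x y hx hy, DGHom.map_add]
      rsmul_left := fun r n x hx => by rw [T.pairing.rsmul_left r n x hx, DGHom.map_rsmul]
      rsmul_right := fun r n x hx => by rw [T.pairing.rsmul_right r n x hx, DGHom.map_rsmul]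
      balanced := fun n b x hx => by rw [T.pairing.balanced n b x hx]
      act_right := fun n b x hx => by rw [T.pairing.act_right n b x hx, DGHom.map_smul]
      grade := fun n x hn hx hxj => DGHom.map_mem _ (T.pairing.grade n x hn hx hxj)
      chain := fun n x hn hx => by
        rw [← DGHom.comm_d, T.pairing.chain n x hn hx, DGHom.map_add, ← DGHom.lin_apply _ (_ • _),
          map_zsmul, DGHom.lin_apply]
      kill := fun n x hx => (DGSubmodule.mkHom_eq_zero _).mpr
        (qs.pair_mem_tensorFilt T.pairing hℓ n hx) }
  univ W γ := by
    obtain ⟨g, hg, huniq⟩ := T.univ W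
      { pair := γ.pair
        add_left := γ.add_left
        add_right := γ.add_right
        rsmul_left := γ.rsmul_left
        rsmul_right := γ.rsmul_right
        balanced := γ.balanced
        act_right := γ.act_right
        grade := γ.grade
        chain := γ.chain
        kill := fun n x hx => hx.elim }
    have hker : qs.tensorFilt T.pairing ℓ ≤ LinearMap.ker g.lin := by
      refine Submodule.span_le.mpr ?_
      rintro _ ⟨i, j, n, x, hn, hx, hxℓ, rfl⟩
      exact (hg n x (qs.filt_subset_filt_one hℓ hxℓ)).trans (γ.kill n x hxℓ)
    refine ⟨(qs.tensorSubmodule T.pairing hℓ).desc g fun x hx => hker hx, hg, ?_⟩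
    intro g' hg' p
    obtain ⟨x, rfl⟩ := DGSubmodule.mkHom_surjective _ p
    exact huniq
      { toFun := fun x => g'.toFun ((qs.tensorSubmodule T.pairing hℓ).mkHom.toFun x)
        map_add := fun x y => by rw [DGHom.map_add, DGHom.map_add]
        map_rsmul := fun r x => by rw [DGHom.map_rsmul, DGHom.map_rsmul]
        map_smul := fun x a => by rw [DGHom.map_smul, DGHom.map_smul]
        map_mem := fun hx => g'.map_mem (DGHom.map_mem _ hx)
        comm_d := fun x => by rw [DGHom.comm_d, DGHom.comm_d] } hg' x

end QuasiSmoothData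

end

/-- Let `φ : A → B` be DG quasi-smooth with diagonal ideal
`J = filt 1` and filtration `J^[ℓ] = filt ℓ`. If `N` is a bounded below semifree
DG `B`-module with `Ext^i_B(N, N ⊗_B J/J^[ℓ]) = 0` for all `i ≥ 0` and all `ℓ ≥ 1`,
then `Ext^i_B(N, N ⊗_B J) = 0` for all `i ≥ 1`. -/
theorem ext_vanish_tensor_diagonal_ideal
    {R : Type} [CommRing R] {A B : DGAlgebra R} (φ : DGAlgHom A B)
    (E : DGAlgebra R) (he : EnvelopingAlg φ E) (πB : DGAlgHom E B)
    (qs : QuasiSmoothData φ E he πB)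
    (N : DGModule R B) (hsf : IsSemifree N) (hbb : BoundedBelow N)
    (hext : ∀ ℓ : ℕ, 1 ≤ ℓ → ∀ i : ℤ, 0 ≤ i → ∀ P : DGModule R B,
      IsTensorSubquot φ he (qs.filt 1) (qs.filt ℓ) N P → ExtVanish i N P) :
    ∀ i : ℤ, 1 ≤ i → ∀ P : DGModule R B,
      IsTensorSubquot φ he (qs.filt 1) ∅ N P → ExtVanish i N P := by
  intro i hi P T
  obtain ⟨n₀, hn₀⟩ := hbb
  have hpos : ∀ ℓ : ℕ, 1 ≤ ℓ + 1 := fun ℓ => by omega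
  refine ExtVanish.of_quotients hsf (fun ℓ => qs.tensorSubmodule T.pairing (hpos ℓ))
    (fun ℓ => qs.tensorFilt_succ_le T.pairing (hpos ℓ)) (fun j => ?_)
    (fun ℓ => hext _ (hpos ℓ) i (by omega) _ (qs.quotientIsTensor T (hpos ℓ)))
    (fun ℓ => hext _ (hpos ℓ) (i - 1) (by omega) _ (qs.quotientIsTensor T (hpos ℓ)))
  exact ⟨(j - n₀).toNat, fun ℓ hℓ x hx hxj =>
    qs.eq_zero_of_mem_tensorFilt T.pairing (hpos ℓ) hn₀ (by push_cast; omega) hx hxj⟩
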